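/- The calculus 𝔊 does not admit cut-elimination: there exists a sequent that is provable in 𝔊 but has no derivation in 𝔊 avoiding the cut rule. -/

import Mathlib

/-- Formulas built from propositional variables and the constant `⊥`
by the connectives `∧`, `∨`, `¬`, `□`. -/
inductive FormulaB : Type where
  | var : ℕ → FormulaB
  | bot : FormulaB
  | and : FormulaB → FormulaB → FormulaB
  | or : FormulaB → FormulaB → FormulaB
  | neg : FormulaB → FormulaB
  | box : FormulaB → FormulaB
deriving DecidableEq
/-- The Font–Rius sequent calculus 𝔊.  `Gder c Δ α` means the sequent `Δ ⇒ α` has a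
derivation; when `c = false` the cut rule is not allowed (cut-free derivability),
`Gder true` is plain derivability. -/
inductive Gder : Bool → Finset FormulaB → FormulaB → Prop where
  | ax (c : Bool) (α : FormulaB) : Gder c {α} α
  | modal (c : Bool) (α : FormulaB) : Gder c ∅ (α.or α.box.neg)
  | weak {c Δ α} (β : FormulaB) : Gder c Δ α → Gder c (insert β Δ) α
  | cut {Δ : Finset FormulaB} {α β : FormulaB} :
      Gder true Δ α → Gder true (insert α Δ) β → Gder true Δ β
  | andL {c Δ γ} (α β : FormulaB) :
      Gder c (insert α (insert β Δ)) γ → Gder c (insert (α.and β) Δ) γ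
  | andR {c Δ} {α β : FormulaB} : Gder c Δ α → Gder c Δ β → Gder c Δ (α.and β)
  | orL {c Δ γ} (α β : FormulaB) :
      Gder c (insert α Δ) γ → Gder c (insert β Δ) γ → Gder c (insert (α.or β) Δ) γ
  | orR1 {c Δ} {α : FormulaB} (β : FormulaB) : Gder c Δ α → Gder c Δ (α.or β)
  | orR2 {c Δ} (α : FormulaB) {β : FormulaB} : Gder c Δ β → Gder c Δ (α.or β)
  | negRule {c} {α β : FormulaB} : Gder c {α} β → Gder c {β.neg} α.neg
  | botRule {c Δ} (α : FormulaB) : Gder c Δ FormulaB.bot → Gder c Δ α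
  | nnL {c Δ β} (α : FormulaB) : Gder c (insert α Δ) β → Gder c (insert α.neg.neg Δ) β
  | nnR {c Δ} {α : FormulaB} : Gder c Δ α → Gder c Δ α.neg.neg
  | boxL {c Δ β} (α : FormulaB) :
      Gder c (insert α (insert α.neg Δ)) β → Gder c (insert α (insert α.box.neg Δ)) β
  | boxR {c Δ} {α : FormulaB} :
      Gder c Δ (α.and α.neg) → Gder c Δ (α.and α.box.neg)

/-- A cut-free derivable sequent whose antecedents all equal one variable has neither `⊥` nor a
negated conjunction as its succedent. -/
theorem Gder.ne_of_subset_var {c : Bool} {Δ : Finset FormulaB} {γ : FormulaB} {n : ℕ}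
    (h : Gder c Δ γ) (hc : c = false) (hΔ : ∀ δ ∈ Δ, δ = FormulaB.var n) :
    γ ≠ FormulaB.bot ∧ ∀ α β : FormulaB, γ ≠ (α.and β).neg := by
  induction h with
  | cut => cases hc
  | weak β _ ih => exact ih hc fun δ hδ => hΔ δ (Finset.mem_insert_of_mem hδ)
  | botRule α _ ih => exact absurd rfl (ih hc hΔ).1
  | _ => simp_all

/-- The cut with cut formula `¬¬α` derives `α ⇒ ¬(¬α ∧ β)`. -/
theorem Gder.neg_neg_and (α β : FormulaB) : Gder true {α} (α.neg.and β).neg := by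
  refine .cut (.nnR (.ax _ α)) ?_
  rw [Finset.pair_comm]
  refine .weak α (.negRule ?_)
  rw [← insert_empty_eq]
  refine .andL _ _ ?_
  rw [insert_empty_eq, Finset.pair_comm]
  exact .weak β (.ax _ _)

/-- 𝔊 does not admit cut-elimination. -/
theorem fontRius_no_cut_elimination :
    ∃ (Δ : Finset FormulaB) (α : FormulaB), Gder true Δ α ∧ ¬ Gder false Δ α :=
  ⟨{.var 0}, _, Gder.neg_neg_and (.var 0) (.var 1), fun h =>
    (h.ne_of_subset_var rfl fun _ => Finset.mem_singleton.1).2 _ _ rfl⟩
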